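/- For every finite, simple, connected, undirected k-regular graph G that is not isomorphic to any of the complete graphs K_1, K_2, or K_3, the Cheeger constant satisfies h(G) ≤ √(k² − λ_1(G)²), where λ_1(G) is the second largest eigenvalue of the adjacency matrix of G. -/

import Mathlib

open scoped Classical

/-- The edge boundary `∂F` of a finite vertex set `F`: the set of edges of `G`
with exactly one endpoint in `F`. -/
noncomputable def edgeBoundary {V : Type*} [Fintype V] (G : SimpleGraph V)
    (F : Finset V) : Finset (Sym2 V) :=
  G.edgeFinset.filter fun e => ∃ a ∈ F, ∃ b ∉ F, e = s(a, b)

/-- The Cheeger constant (isoperimetric constant / edge expansion constant)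
`h(G) = min { |∂F|/|F| : F ⊆ V nonempty, |F| ≤ |V|/2 }`. -/
noncomputable def cheegerConstant {V : Type*} [Fintype V] (G : SimpleGraph V) : ℝ :=
  sInf {x : ℝ | ∃ F : Finset V, F.Nonempty ∧ 2 * F.card ≤ Fintype.card V ∧
    x = (edgeBoundary G F).card / F.card}

theorem adjMatrix_isHermitian {n : ℕ} (G : SimpleGraph (Fin n)) :
    (G.adjMatrix ℝ).IsHermitian := by
  show Matrix.conjTranspose (G.adjMatrix ℝ) = G.adjMatrix ℝ
  rw [Matrix.conjTranspose_eq_transpose_of_trivial]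
  exact G.isSymm_adjMatrix

/-- The list of eigenvalues of the adjacency matrix of `G`, with multiplicity,
sorted in decreasing order: `λ_0(G) ≥ λ_1(G) ≥ ⋯ ≥ λ_{n-1}(G)`. -/
noncomputable def adjacencySpectrum {n : ℕ} (G : SimpleGraph (Fin n)) : List ℝ :=
  ((Finset.univ.val.map (adjMatrix_isHermitian G).eigenvalues).sort (· ≤ ·)).reverse

/-- `λ_1(G)`, the second largest eigenvalue (with multiplicity) of the
adjacency matrix of `G`. -/
noncomputable def secondLargestEigenvalue {n : ℕ} (G : SimpleGraph (Fin n)) : ℝ :=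
  (adjacencySpectrum G).getD 1 0

section WeightedCut

variable {V : Type*} [Fintype V]

theorem sum_mul_abs_indicator_sub {A : V → V → ℝ} (hsymm : ∀ u v, A u v = A v u) (S : Finset V) :
    ∑ u, ∑ v, A u v * |(if u ∈ S then (1 : ℝ) else 0) - (if v ∈ S then 1 else 0)| =
      2 * ∑ u ∈ S, ∑ v ∈ Sᶜ, A u v := by
  have hsplit : ∀ u v, A u v * |(if u ∈ S then (1 : ℝ) else 0) - (if v ∈ S then 1 else 0)| =
      (if u ∈ S then if v ∈ Sᶜ then A u v else 0 else 0) +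
        (if v ∈ S then if u ∈ Sᶜ then A v u else 0 else 0) := by
    intro u v
    by_cases hu : u ∈ S <;> by_cases hv : v ∈ S <;> simp [hu, hv, hsymm u v]
  have hcut : ∑ u, ∑ v, (if u ∈ S then if v ∈ Sᶜ then A u v else 0 else 0) =
      ∑ u ∈ S, ∑ v ∈ Sᶜ, A u v := by
    simp only [Finset.sum_ite_irrel, Finset.sum_const_zero, Finset.sum_ite_mem, Finset.univ_inter]
  simp only [hsplit, Finset.sum_add_distrib]
  rw [Finset.sum_comm (f := fun u v => if v ∈ S then if u ∈ Sᶜ then A v u else 0 else 0), hcut]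
  ring

/-- The discrete co-area inequality. -/
theorem two_mul_mul_sum_le_sum_mul_abs_sub {A : V → V → ℝ} (hsymm : ∀ u v, A u v = A v u) {h : ℝ}
    (hcut : ∀ F : Finset V, F.Nonempty → 2 * F.card ≤ Fintype.card V →
      h * F.card ≤ ∑ u ∈ F, ∑ v ∈ Fᶜ, A u v)
    (w : V → ℝ) (hw : ∀ v, 0 ≤ w v)
    (hcard : 2 * (Finset.univ.filter fun v => 0 < w v).card ≤ Fintype.card V) :
    2 * h * ∑ v, w v ≤ ∑ u, ∑ v, A u v * |w u - w v| := by
  induction hN : (Finset.univ.filter fun v => 0 < w v).card using Nat.strong_induction_on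
    generalizing w with
  | _ N ih =>
  set S := Finset.univ.filter fun v => 0 < w v with hS
  have hmem : ∀ v, v ∈ S ↔ 0 < w v := by simp [hS]
  rcases S.eq_empty_or_nonempty with hempty | hne
  · have hzero : ∀ v, w v = 0 := fun v =>
      le_antisymm (not_lt.1 fun hv => by simpa [hempty] using (hmem v).2 hv) (hw v)
    simp [hzero]
  obtain ⟨a, haS, hmin⟩ := S.exists_min_image w hne
  set w₁ : V → ℝ := fun v => w v - w a * (if v ∈ S then 1 else 0) with hw₁
  have ha : 0 < w a := (hmem a).1 haS
  have hout : ∀ v, v ∉ S → w v = 0 := fun v hv =>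
    le_antisymm (not_lt.1 fun h0 => hv ((hmem v).2 h0)) (hw v)
  have hw₁_nonneg : ∀ v, 0 ≤ w₁ v := by
    intro v
    by_cases hv : v ∈ S
    · simpa [hw₁, hv] using hmin v hv
    · simp [hw₁, hv, hout v hv]
  have hsub : (Finset.univ.filter fun v => 0 < w₁ v) ⊂ S := by
    refine (Finset.ssubset_iff_of_subset ?_).2 ⟨a, haS, by simp [hw₁, haS]⟩
    intro v hv
    by_contra hvS
    simp [hw₁, hvS, hout v hvS] at hv
  have hlt := Finset.card_lt_card hsub
  have hrec := ih _ (hN ▸ hlt) w₁ hw₁_nonneg (by omega) rfl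
  have habs : ∀ u v, A u v * |w u - w v| = A u v * |w₁ u - w₁ v| +
      w a * (A u v * |(if u ∈ S then (1 : ℝ) else 0) - (if v ∈ S then 1 else 0)|) := by
    intro u v
    by_cases hu : u ∈ S <;> by_cases hv : v ∈ S
    · simp [hw₁, hu, hv]
    · have := hmin u hu
      simp only [hw₁, hu, hv, hout v hv, if_true, if_false]
      rw [abs_of_nonneg (by linarith), abs_of_nonneg (by linarith)]
      norm_num
      ring
    · have := hmin v hv
      simp only [hw₁, hu, hv, hout u hu, if_true, if_false]
      rw [abs_of_nonpos (by linarith), abs_of_nonpos (by linarith)]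
      norm_num
      ring
    · simp [hw₁, hu, hv]
  have hsum : ∑ v, w v = ∑ v, w₁ v + w a * S.card := by
    simp [hw₁, Finset.sum_sub_distrib, mul_comm]
  have hS_cut := mul_le_mul_of_nonneg_left (hcut S hne hcard) ha.le
  simp only [habs, Finset.sum_add_distrib, ← Finset.mul_sum, sum_mul_abs_indicator_sub hsymm]
  rw [hsum]
  linarith

theorem sq_mul_sq_sum_le_of_nonneg {A : V → V → ℝ} (hsymm : ∀ u v, A u v = A v u)
    (hA : ∀ u v, 0 ≤ A u v) {k h : ℝ} (hrow : ∀ u, ∑ v, A u v = k) (hh : 0 ≤ h)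
    (hcut : ∀ F : Finset V, F.Nonempty → 2 * F.card ≤ Fintype.card V →
      h * F.card ≤ ∑ u ∈ F, ∑ v ∈ Fᶜ, A u v)
    (g : V → ℝ) (hg : ∀ v, 0 ≤ g v)
    (hcard : 2 * (Finset.univ.filter fun v => 0 < g v).card ≤ Fintype.card V) :
    h ^ 2 * (∑ v, g v ^ 2) ^ 2 ≤
      k ^ 2 * (∑ v, g v ^ 2) ^ 2 - (∑ u, ∑ v, A u v * (g u * g v)) ^ 2 := by
  have hpos : ∀ v, 0 < g v ^ 2 ↔ 0 < g v := fun v =>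
    ⟨fun hv => (hg v).lt_of_ne fun h0 => by simp [← h0] at hv, fun hv => by positivity⟩
  have hcoarea := two_mul_mul_sum_le_sum_mul_abs_sub hsymm hcut (fun v => g v ^ 2)
    (fun v => sq_nonneg _) (by simpa only [hpos] using hcard)
  have hcs := Finset.sum_mul_sq_le_sq_mul_sq (Finset.univ : Finset (V × V))
    (fun p => √(A p.1 p.2) * |g p.1 - g p.2|) (fun p => √(A p.1 p.2) * (g p.1 + g p.2))
  have hleft : ∑ u, ∑ v, A u v * g u ^ 2 = k * ∑ v, g v ^ 2 := by
    simp only [← Finset.sum_mul, hrow, ← Finset.mul_sum]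
  have hright : ∑ u, ∑ v, A u v * g v ^ 2 = k * ∑ v, g v ^ 2 := by
    rw [Finset.sum_comm, ← hleft]
    exact Finset.sum_congr rfl fun u _ => Finset.sum_congr rfl fun v _ => by rw [hsymm]
  have hprod : ∑ p : V × V, √(A p.1 p.2) * |g p.1 - g p.2| * (√(A p.1 p.2) * (g p.1 + g p.2)) =
      ∑ u, ∑ v, A u v * |g u ^ 2 - g v ^ 2| := by
    rw [Fintype.sum_prod_type]
    refine Finset.sum_congr rfl fun u _ => Finset.sum_congr rfl fun v _ => ?_
    rw [sq_sub_sq, abs_mul, abs_of_nonneg (add_nonneg (hg u) (hg v))]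
    linear_combination |g u - g v| * (g u + g v) * Real.mul_self_sqrt (hA u v)
  have hdiff : ∑ p : V × V, (√(A p.1 p.2) * |g p.1 - g p.2|) ^ 2 =
      2 * (k * ∑ v, g v ^ 2) - 2 * ∑ u, ∑ v, A u v * (g u * g v) := by
    have hterm : ∀ u v, (√(A u v) * |g u - g v|) ^ 2 =
        A u v * g u ^ 2 + A u v * g v ^ 2 - 2 * (A u v * (g u * g v)) := fun u v => by
      rw [mul_pow, Real.sq_sqrt (hA u v), sq_abs]; ring
    rw [Fintype.sum_prod_type]
    simp only [hterm, Finset.sum_sub_distrib, Finset.sum_add_distrib, ← Finset.mul_sum _ _ (2 : ℝ)]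
    rw [hleft, hright]
    ring
  have hadd : ∑ p : V × V, (√(A p.1 p.2) * (g p.1 + g p.2)) ^ 2 =
      2 * (k * ∑ v, g v ^ 2) + 2 * ∑ u, ∑ v, A u v * (g u * g v) := by
    have hterm : ∀ u v, (√(A u v) * (g u + g v)) ^ 2 =
        A u v * g u ^ 2 + A u v * g v ^ 2 + 2 * (A u v * (g u * g v)) := fun u v => by
      rw [mul_pow, Real.sq_sqrt (hA u v)]; ring
    rw [Fintype.sum_prod_type]
    simp only [hterm, Finset.sum_add_distrib, ← Finset.mul_sum _ _ (2 : ℝ)]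
    rw [hleft, hright]
    ring
  rw [hprod, hdiff, hadd] at hcs
  have hN : 0 ≤ ∑ v, g v ^ 2 := Finset.sum_nonneg fun v _ => sq_nonneg _
  have hsq := pow_le_pow_left₀ (by positivity) hcoarea 2
  nlinarith

/-- A nonzero eigenvector orthogonal to the constants, with nonnegative eigenvalue, bounds the
edge expansion of a weighted regular graph. -/
theorem sq_le_sq_sub_sq_of_eigenvector {A : V → V → ℝ} (hsymm : ∀ u v, A u v = A v u)
    (hA : ∀ u v, 0 ≤ A u v) {k h μ : ℝ} (hrow : ∀ u, ∑ v, A u v = k) (hh : 0 ≤ h)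
    (hcut : ∀ F : Finset V, F.Nonempty → 2 * F.card ≤ Fintype.card V →
      h * F.card ≤ ∑ u ∈ F, ∑ v ∈ Fᶜ, A u v)
    (hμ : 0 ≤ μ) (f : V → ℝ) (hf : f ≠ 0) (hsum : ∑ v, f v = 0)
    (heig : ∀ u, ∑ v, A u v * f v = μ * f u) :
    h ^ 2 ≤ k ^ 2 - μ ^ 2 := by
  wlog hsmall : 2 * (Finset.univ.filter fun v => 0 < f v).card ≤ Fintype.card V generalizing f
  · refine this (-f) (neg_ne_zero.2 hf) (by simp [hsum]) (fun u => by simp [heig u]) ?_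
    have hdisj : Disjoint (Finset.univ.filter fun v => 0 < f v)
        (Finset.univ.filter fun v => 0 < (-f) v) := by
      refine Finset.disjoint_filter.2 fun v _ h1 h2 => ?_
      simp only [Pi.neg_apply] at h2
      linarith
    have := Finset.card_le_univ
      ((Finset.univ.filter fun v => 0 < f v).disjUnion (Finset.univ.filter fun v => 0 < (-f) v) hdisj)
    rw [Finset.card_disjUnion] at this
    omega
  obtain ⟨a, ha⟩ : ∃ a, 0 < f a := by
    by_contra! hneg
    exact hf (funext fun v => (Finset.sum_eq_zero_iff_of_nonpos fun v _ => hneg v).1 hsum v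
      (Finset.mem_univ v))
  set g : V → ℝ := fun v => max (f v) 0 with hg
  have hg0 : ∀ v, 0 ≤ g v := fun v => le_max_right _ _
  have hbound := sq_mul_sq_sum_le_of_nonneg hsymm hA hrow hh hcut g hg0 (by simpa [hg] using hsmall)
  have hN : 0 < ∑ v, g v ^ 2 :=
    Finset.sum_pos' (fun v _ => sq_nonneg _) ⟨a, Finset.mem_univ a, by
      have : 0 < g a := lt_max_of_lt_left ha
      positivity⟩
  have hquad : μ * ∑ v, g v ^ 2 ≤ ∑ u, ∑ v, A u v * (g u * g v) := by
    rw [Finset.mul_sum]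
    refine Finset.sum_le_sum fun u _ => ?_
    have hu : ∑ v, A u v * (g u * g v) = g u * ∑ v, A u v * g v := by
      rw [Finset.mul_sum]
      exact Finset.sum_congr rfl fun v _ => by ring
    rw [hu]
    rcases le_total (f u) 0 with h0 | h0
    · simp [hg, max_eq_right h0]
    · have hle : μ * g u ≤ ∑ v, A u v * g v := by
        rw [show g u = f u from max_eq_left h0, ← heig u]
        exact Finset.sum_le_sum fun v _ => mul_le_mul_of_nonneg_left (le_max_left _ _) (hA u v)
      nlinarith [mul_le_mul_of_nonneg_left hle (hg0 u)]
  have hsq := pow_le_pow_left₀ (by positivity) hquad 2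
  have hN2 : 0 < (∑ v, g v ^ 2) ^ 2 := by positivity
  refine le_of_mul_le_mul_right ?_ hN2
  nlinarith

end WeightedCut

section Cheeger

variable {V : Type*} [Fintype V] (G : SimpleGraph V)

theorem card_edgeBoundary (F : Finset V) :
    ((edgeBoundary G F).card : ℝ) = ∑ u ∈ F, ∑ v ∈ Fᶜ, G.adjMatrix ℝ u v := by
  have himage : edgeBoundary G F =
      ((F ×ˢ Fᶜ).filter fun p => G.Adj p.1 p.2).image fun p => s(p.1, p.2) := by
    ext e
    simp only [edgeBoundary, Finset.mem_filter, Finset.mem_image, Finset.mem_product,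
      Finset.mem_compl, SimpleGraph.mem_edgeFinset, Prod.exists]
    constructor
    · rintro ⟨he, a, ha, b, hb, rfl⟩
      exact ⟨a, b, ⟨⟨ha, hb⟩, he⟩, rfl⟩
    · rintro ⟨a, b, ⟨⟨ha, hb⟩, he⟩, rfl⟩
      exact ⟨he, a, ha, b, hb, rfl⟩
  rw [himage, Finset.card_image_of_injOn, Finset.card_filter, Finset.sum_product]
  · push_cast
    simp [SimpleGraph.adjMatrix_apply]
  · rintro ⟨a, b⟩ hab ⟨c, d⟩ hcd heq
    simp only [Finset.coe_filter, Finset.mem_product, Finset.mem_compl, Set.mem_ofPred_eq]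
      at hab hcd
    rcases Sym2.eq_iff.1 heq with ⟨rfl, rfl⟩ | ⟨rfl, rfl⟩
    · rfl
    · exact absurd hab.1.1 hcd.1.2

theorem cheegerConstant_nonneg : 0 ≤ cheegerConstant G :=
  Real.sInf_nonneg (by rintro x ⟨F, -, -, rfl⟩; positivity)

theorem cheegerConstant_le {F : Finset V} (hF : F.Nonempty) (hcard : 2 * F.card ≤ Fintype.card V) :
    cheegerConstant G ≤ (edgeBoundary G F).card / F.card :=
  csInf_le ⟨0, by rintro x ⟨F, -, -, rfl⟩; positivity⟩ ⟨F, hF, hcard, rfl⟩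

theorem cheegerConstant_mul_card_le {F : Finset V} (hF : F.Nonempty)
    (hcard : 2 * F.card ≤ Fintype.card V) :
    cheegerConstant G * F.card ≤ ∑ u ∈ F, ∑ v ∈ Fᶜ, G.adjMatrix ℝ u v := by
  rw [← card_edgeBoundary]
  exact (le_div_iff₀ (by exact_mod_cast hF.card_pos)).1 (cheegerConstant_le G hF hcard)

theorem cheegerConstant_le_half_card_add_one (hV : 2 ≤ Fintype.card V) :
    cheegerConstant G ≤ (Fintype.card V + 1) / 2 := by
  obtain ⟨F, -, hF⟩ := Finset.exists_subset_card_eq (s := (Finset.univ : Finset V))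
    (n := Fintype.card V / 2) (by rw [Finset.card_univ]; omega)
  have hpos : 0 < F.card := by omega
  have hcut := cheegerConstant_mul_card_le G (Finset.card_pos.1 hpos) (by omega)
  have hle : ∑ u ∈ F, ∑ v ∈ Fᶜ, G.adjMatrix ℝ u v ≤ F.card * Fᶜ.card := by
    have : ∀ u ∈ F, ∑ v ∈ Fᶜ, G.adjMatrix ℝ u v ≤ Fᶜ.card := fun u _ => by
      refine (Finset.sum_le_card_nsmul _ _ 1 fun v _ => ?_).trans_eq (by simp)
      rw [SimpleGraph.adjMatrix_apply]
      split_ifs <;> norm_num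
    exact (Finset.sum_le_card_nsmul _ _ _ this).trans_eq (by simp)
  have hposR : (0 : ℝ) < F.card := by exact_mod_cast hpos
  have hcompl : 2 * Fᶜ.card ≤ Fintype.card V + 1 := by
    rw [Finset.card_compl]
    omega
  have hcomplR : 2 * (Fᶜ.card : ℝ) ≤ Fintype.card V + 1 := by exact_mod_cast hcompl
  have : cheegerConstant G ≤ Fᶜ.card := le_of_mul_le_mul_right (by linarith) hposR
  linarith

end Cheeger

section Spectrum

theorem exists_getD_one_reverse_sort {n : ℕ} (hn : 2 ≤ n) (a : Fin n → ℝ) :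
    ∃ i j, i ≠ j ∧ ((Finset.univ.val.map a).sort (· ≤ ·)).reverse.getD 1 0 = a j ∧ a j ≤ a i ∧
      ∀ l, l ≠ i → a l ≤ a j := by
  let σ := Tuple.sort (fun i => -a i)
  have hanti : Antitone (a ∘ σ) := fun x y hxy => by
    simpa using Tuple.monotone_sort (fun i => -a i) hxy
  have hlist : ((Finset.univ.val.map a).sort (· ≤ ·)).reverse = List.ofFn (a ∘ σ) := by
    refine List.Perm.eq_of_sortedGE ?_ hanti.sortedGE_ofFn ?_
    · exact (List.pairwise_reverse.2 (Multiset.pairwise_sort _ _)).sortedGE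
    · refine (List.reverse_perm _).trans (List.Perm.trans ?_ (σ.ofFn_comp_perm a).symm)
      rw [← Multiset.coe_eq_coe, Multiset.sort_eq]
      simp [List.ofFn_eq_map]
  refine ⟨σ ⟨0, by omega⟩, σ ⟨1, by omega⟩, by simp, ?_, hanti (by simp), fun l hl => ?_⟩
  · rw [hlist, List.getD_eq_getElem _ _ (by simpa using (by omega : 1 < n))]
    simp
  · have hl_ne : σ.symm l ≠ ⟨0, by omega⟩ := fun h0 => hl (by rw [← h0, Equiv.apply_symm_apply])
    have hle : (⟨1, by omega⟩ : Fin n) ≤ σ.symm l := by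
      have : (σ.symm l).val ≠ 0 := fun h0 => hl_ne (Fin.ext h0)
      exact Fin.mk_le_of_le_val (by omega)
    simpa using hanti hle

variable {V : Type*} [Fintype V]

theorem Matrix.IsHermitian.exists_orthonormal_eigenvectors [DecidableEq V] {A : Matrix V V ℝ}
    (hA : A.IsHermitian) :
    ∃ f : V → V → ℝ, (∀ l u, ∑ v, A u v * f l v = hA.eigenvalues l * f l u) ∧
      (∀ l m, ∑ v, f l v * f m v = if l = m then 1 else 0) ∧
      (∀ u v, ∑ l, f l u * f l v = if u = v then 1 else 0) ∧
      ∀ u v, A u v = ∑ l, hA.eigenvalues l * (f l u * f l v) := by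
  let U : Matrix V V ℝ := (hA.eigenvectorUnitary : Matrix V V ℝ)
  have hrows : U * star U = 1 := Unitary.coe_mul_star_self _
  have hcols : star U * U = 1 := Unitary.coe_star_mul_self _
  have heig : ∀ l u, ∑ v, A u v * U v l = hA.eigenvalues l * U u l := fun l u =>
    congrFun (hA.mulVec_eigenvectorBasis l) u
  have hcomplete : ∀ u v, ∑ l, U u l * U v l = if u = v then 1 else 0 := fun u v => by
    simpa [Matrix.mul_apply, Matrix.one_apply] using congrFun (congrFun hrows u) v
  refine ⟨fun l v => U v l, heig, fun l m => ?_, hcomplete, fun u v => ?_⟩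
  · simpa [Matrix.mul_apply, Matrix.one_apply] using congrFun (congrFun hcols l) m
  · calc A u v = ∑ w, A u w * ∑ l, U w l * U v l := by simp [hcomplete]
      _ = ∑ l, (∑ w, A u w * U w l) * U v l := by
        simp only [Finset.mul_sum, Finset.sum_mul]
        rw [Finset.sum_comm]
        simp only [mul_assoc]
      _ = _ := by simp only [heig, mul_assoc]

theorem sum_eq_zero_of_eigenvalue_ne {A : V → V → ℝ} (hsymm : ∀ u v, A u v = A v u) {k μ : ℝ}
    (hrow : ∀ u, ∑ v, A u v = k) (hne : μ ≠ k) {f : V → ℝ}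
    (heig : ∀ u, ∑ v, A u v * f v = μ * f u) : ∑ v, f v = 0 := by
  have hsum : μ * ∑ u, f u = k * ∑ u, f u := by
    rw [Finset.mul_sum, Finset.mul_sum, ← Finset.sum_congr rfl fun u _ => heig u, Finset.sum_comm]
    refine Finset.sum_congr rfl fun v _ => ?_
    rw [← Finset.sum_mul, ← hrow v]
    simp only [hsymm v]
  exact (mul_eq_zero.1 (by linarith : (μ - k) * ∑ u, f u = 0)).resolve_left (sub_ne_zero.2 hne)

/-- A symmetric matrix with a vanishing principal `2 × 2` block cannot have all its eigenvalues
but one negative. -/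
theorem Matrix.IsHermitian.exists_eigenvalue_nonneg [DecidableEq V] {A : Matrix V V ℝ}
    (hA : A.IsHermitian) {u v : V} (huv : u ≠ v) (huu : A u u = 0) (hvv : A v v = 0)
    (h0 : A u v = 0) (i : V) : ∃ l, l ≠ i ∧ 0 ≤ hA.eigenvalues l := by
  by_contra! hneg
  obtain ⟨f, -, -, hcomplete, hspec⟩ := hA.exists_orthonormal_eigenvectors
  have key : ∀ a b : ℝ, b * f i u = a * f i v → b ^ 2 + a ^ 2 = 0 := by
    intro a b hab
    have hquad : ∑ l, hA.eigenvalues l * (b * f l u - a * f l v) ^ 2 = 0 := by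
      calc _ = b ^ 2 * A u u - 2 * (a * b) * A u v + a ^ 2 * A v v := by
            simp only [hspec, Finset.mul_sum, ← Finset.sum_sub_distrib, ← Finset.sum_add_distrib]
            exact Finset.sum_congr rfl fun l _ => by ring
        _ = 0 := by simp [huu, hvv, h0]
    have hterm : ∀ l, hA.eigenvalues l * (b * f l u - a * f l v) ^ 2 ≤ 0 := fun l => by
      by_cases hl : l = i
      · simp [hl, hab]
      · exact mul_nonpos_of_nonpos_of_nonneg (hneg l hl).le (sq_nonneg _)
    have hzero : ∀ l, b * f l u - a * f l v = 0 := fun l => by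
      by_cases hl : l = i
      · simp [hl, hab]
      · have := (Finset.sum_eq_zero_iff_of_nonpos fun l _ => hterm l).1 hquad l (Finset.mem_univ l)
        simpa [(hneg l hl).ne] using this
    calc b ^ 2 + a ^ 2 = b ^ 2 * ∑ l, f l u * f l u - 2 * (a * b) * ∑ l, f l u * f l v +
            a ^ 2 * ∑ l, f l v * f l v := by simp [hcomplete, huv]
      _ = ∑ l, (b * f l u - a * f l v) ^ 2 := by
        simp only [Finset.mul_sum, ← Finset.sum_sub_distrib, ← Finset.sum_add_distrib]
        exact Finset.sum_congr rfl fun l _ => by ring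
      _ = 0 := by simp [hzero]
  have hzero := key (f i u) (f i v) (mul_comm _ _)
  have hu : f i u = 0 := by nlinarith [sq_nonneg (f i u), sq_nonneg (f i v)]
  simpa using key 0 1 (by simp [hu])

end Spectrum

theorem cheegerConstant_sq_le_of_secondLargestEigenvalue_nonneg {n k : ℕ} (hn : 2 ≤ n)
    (G : SimpleGraph (Fin n)) (hrow : ∀ u, ∑ v, G.adjMatrix ℝ u v = k)
    (hnonneg : 0 ≤ secondLargestEigenvalue G) :
    cheegerConstant G ^ 2 ≤ (k : ℝ) ^ 2 - secondLargestEigenvalue G ^ 2 := by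
  obtain ⟨i, j, hij, hj, hji, -⟩ :=
    exists_getD_one_reverse_sort hn (adjMatrix_isHermitian G).eigenvalues
  change secondLargestEigenvalue G = _ at hj
  rw [hj] at hnonneg ⊢
  obtain ⟨f, heig, horth, -, -⟩ := (adjMatrix_isHermitian G).exists_orthonormal_eigenvectors
  set ev := (adjMatrix_isHermitian G).eigenvalues
  have hsymm : ∀ u v, G.adjMatrix ℝ u v = G.adjMatrix ℝ v u := fun u v =>
    (G.isSymm_adjMatrix (α := ℝ)).apply v u
  have hA : ∀ u v, 0 ≤ G.adjMatrix ℝ u v := fun u v => by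
    rw [SimpleGraph.adjMatrix_apply]
    split_ifs <;> norm_num
  have hf : ∀ l, f l ≠ 0 := fun l h0 => by simpa [h0] using horth l l
  have hbound := fun μ => sq_le_sq_sub_sq_of_eigenvector (μ := μ) hsymm hA hrow
    (cheegerConstant_nonneg G) fun F hF hcard => cheegerConstant_mul_card_le G hF hcard
  by_cases hi : ev i = k
  · by_cases hjk : ev j = k
    · by_cases hs : ∑ v, f j v = 0
      · exact hbound _ hnonneg (f j) (hf j) hs (heig j)
      · refine hbound _ hnonneg (fun v => (∑ w, f j w) * f i v - (∑ w, f i w) * f j v) ?_ ?_ ?_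
        · intro h0
          have hinner : ∑ v, ((∑ w, f j w) * f i v - (∑ w, f i w) * f j v) * f i v =
              ∑ w, f j w := by
            calc _ = (∑ w, f j w) * ∑ v, f i v * f i v - (∑ w, f i w) * ∑ v, f j v * f i v := by
                  rw [Finset.mul_sum, Finset.mul_sum, ← Finset.sum_sub_distrib]
                  exact Finset.sum_congr rfl fun v _ => by ring
              _ = _ := by simp [horth, hij.symm]
          refine hs (hinner.symm.trans (Finset.sum_eq_zero fun v _ => ?_))
          rw [congrFun h0 v]
          simp
        · rw [Finset.sum_sub_distrib, ← Finset.mul_sum, ← Finset.mul_sum]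
          ring
        · intro u
          calc _ = (∑ w, f j w) * ∑ v, G.adjMatrix ℝ u v * f i v -
                (∑ w, f i w) * ∑ v, G.adjMatrix ℝ u v * f j v := by
                rw [Finset.mul_sum, Finset.mul_sum, ← Finset.sum_sub_distrib]
                exact Finset.sum_congr rfl fun v _ => by ring
            _ = _ := by
              rw [heig, heig]
              rw [hi, hjk]
              ring
    · exact hbound _ hnonneg (f j) (hf j)
        (sum_eq_zero_of_eigenvalue_ne hsymm hrow hjk (heig j)) (heig j)
  · refine (hbound _ (hnonneg.trans hji) (f i) (hf i)
      (sum_eq_zero_of_eigenvalue_ne hsymm hrow hi (heig i)) (heig i)).trans ?_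
    have := pow_le_pow_left₀ hnonneg hji 2
    linarith

theorem secondLargestEigenvalue_nonneg_of_ne_top {n : ℕ} (hn : 2 ≤ n) (G : SimpleGraph (Fin n))
    (hG : G ≠ ⊤) : 0 ≤ secondLargestEigenvalue G := by
  obtain ⟨i, j, -, hj, -, hmax⟩ :=
    exists_getD_one_reverse_sort hn (adjMatrix_isHermitian G).eigenvalues
  change secondLargestEigenvalue G = _ at hj
  obtain ⟨u, v, huv, hnadj⟩ := SimpleGraph.ne_top_iff_exists_not_adj.1 hG
  obtain ⟨l, hl, h0⟩ := (adjMatrix_isHermitian G).exists_eigenvalue_nonneg huv (by simp) (by simp)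
    (by simp [hnadj]) i
  rw [hj]
  exact h0.trans (hmax l hl)

theorem sum_adjMatrix_mul_of_eq_top {V : Type*} [Fintype V] {G : SimpleGraph V} (hG : G = ⊤)
    (g : V → ℝ) (u : V) : ∑ v, G.adjMatrix ℝ u v * g v = ∑ v, g v - g u := by
  have hterm : ∀ v, G.adjMatrix ℝ u v * g v = g v - if u = v then g v else 0 := fun v => by
    by_cases huv : u = v <;> simp [SimpleGraph.adjMatrix_apply, hG, huv]
  rw [Finset.sum_congr rfl fun v _ => hterm v, Finset.sum_sub_distrib]
  simp

theorem secondLargestEigenvalue_eq_neg_one_of_eq_top {n : ℕ} (hn : 2 ≤ n) {G : SimpleGraph (Fin n)}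
    (hG : G = ⊤) (hneg : secondLargestEigenvalue G < 0) : secondLargestEigenvalue G = -1 := by
  obtain ⟨i, j, -, hj, -, -⟩ :=
    exists_getD_one_reverse_sort hn (adjMatrix_isHermitian G).eigenvalues
  change secondLargestEigenvalue _ = _ at hj
  obtain ⟨f, heig, horth, -, -⟩ := (adjMatrix_isHermitian G).exists_orthonormal_eigenvectors
  replace heig := heig j
  rw [← hj] at heig
  have hsum : ∑ v, f j v = 0 := by
    refine sum_eq_zero_of_eigenvalue_ne (k := (n : ℝ) - 1)
      (fun u v => (G.isSymm_adjMatrix (α := ℝ)).apply v u)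
      (fun u => by simpa using sum_adjMatrix_mul_of_eq_top hG 1 u) ?_ heig
    have : (2 : ℝ) ≤ n := by exact_mod_cast hn
    linarith
  have hne : f j ≠ 0 := fun h0 => by simpa [h0] using horth j j
  obtain ⟨u, hu⟩ := Function.ne_iff.1 hne
  have := heig u
  rw [sum_adjMatrix_mul_of_eq_top hG, hsum] at this
  exact mul_right_cancel₀ hu (by linarith)

/-- For every finite, simple, connected, undirected `k`-regular graph `G` that is
not isomorphic to any of the complete graphs `K_1`, `K_2`, or `K_3`, the Cheeger
constant satisfies `h(G) ≤ √(k² − λ_1(G)²)`. -/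
theorem cheeger_upper_bound_mohar_spectral {n k : ℕ} (G : SimpleGraph (Fin n))
    (hconn : G.Connected) (hreg : G.IsRegularOfDegree k)
    (h1 : ¬ Nonempty (G ≃g (⊤ : SimpleGraph (Fin 1))))
    (h2 : ¬ Nonempty (G ≃g (⊤ : SimpleGraph (Fin 2))))
    (h3 : ¬ Nonempty (G ≃g (⊤ : SimpleGraph (Fin 3)))) :
    cheegerConstant G ≤ Real.sqrt ((k : ℝ) ^ 2 - secondLargestEigenvalue G ^ 2) := by
  refine Real.le_sqrt_of_sq_le ?_
  have hrow : ∀ u, ∑ v, G.adjMatrix ℝ u v = k := fun u => by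
    rw [← hreg u, ← SimpleGraph.card_neighborFinset_eq_degree]
    simp [SimpleGraph.adjMatrix_apply, SimpleGraph.neighborFinset_eq_filter]
  have hn0 : n ≠ 0 := by
    rintro rfl
    exact hconn.nonempty.elim Fin.elim0
  have hn1 : n ≠ 1 := by
    rintro rfl
    exact h1 ⟨Subsingleton.elim G ⊤ ▸ SimpleGraph.Iso.refl⟩
  have hn : 2 ≤ n := by omega
  rcases le_or_gt 0 (secondLargestEigenvalue G) with hnonneg | hneg
  · exact cheegerConstant_sq_le_of_secondLargestEigenvalue_nonneg hn G hrow hnonneg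
  have hG : G = ⊤ := by
    by_contra hG
    exact hneg.not_ge (secondLargestEigenvalue_nonneg_of_ne_top hn G hG)
  have hn2 : n ≠ 2 := by
    rintro rfl
    exact h2 ⟨hG ▸ SimpleGraph.Iso.refl⟩
  have hn3 : n ≠ 3 := by
    rintro rfl
    exact h3 ⟨hG ▸ SimpleGraph.Iso.refl⟩
  have hk : (k : ℝ) = n - 1 := by
    rw [← hrow ⟨0, by omega⟩]
    simpa using sum_adjMatrix_mul_of_eq_top hG 1 ⟨0, by omega⟩
  have hle := cheegerConstant_le_half_card_add_one G (by simpa using hn)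
  rw [Fintype.card_fin] at hle
  have h4 : (4 : ℝ) ≤ n := by exact_mod_cast (by omega : 4 ≤ n)
  rw [secondLargestEigenvalue_eq_neg_one_of_eq_top hn hG hneg, hk]
  have hsq := pow_le_pow_left₀ (cheegerConstant_nonneg _) hle 2
  nlinarith
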